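/- Let 1 ≤ s ≤ N, 1 ≤ k ≤ m ≤ N, λ > 0, and set η = (s + λ²k)/min{s, λ²k}. Suppose A ∈ ℂ^{m×N} satisfies the Restricted Isometry Property for the sparse corruptions problem of order (2s, 2k) with constant δ_{2s,2k} < 1/√(1 + (1/(2√2) + √η)²). Then there exist constants C₁, C₂ > 0 depending only on δ_{2s,2k} such that: for any x ∈ ℂ^N, c ∈ ℂ^m, y ∈ ℂ^m and ε > 0 with ‖Ax + c − y‖₂ ≤ ε, and any minimizer (x̂, ĉ) of ‖z‖₁ + λ‖d‖₁ over pairs (z,d) subject to ‖Az + d − y‖₂ ≤ ε, one has ‖x − x̂‖₁ + λ‖c − ĉ‖₁ ≤ C₁(σ_s(x)₁ + λ·σ_k(c)₁) + C₂·√(s + λ²k)·ε. -/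

import Mathlib

open Finset Matrix MeasureTheory

noncomputable def l1norm {n : ℕ} (x : Fin n → ℂ) : ℝ := ∑ i, ‖x i‖

noncomputable def l2norm {n : ℕ} (x : Fin n → ℂ) : ℝ := Real.sqrt (∑ i, ‖x i‖ ^ 2)

/-- The vector equal to `x` on `S` and zero elsewhere. -/
def restr {n : ℕ} (x : Fin n → ℂ) (S : Finset (Fin n)) : Fin n → ℂ :=
  fun i => if i ∈ S then x i else 0

/-- `x` has at most `s` nonzero entries. -/
def IsSparse {n : ℕ} (s : ℕ) (x : Fin n → ℂ) : Prop :=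
  ∃ S : Finset (Fin n), S.card ≤ s ∧ ∀ i ∉ S, x i = 0

/-- Best `s`-term approximation error of `x` in the `ℓ¹` norm. -/
noncomputable def sigma1 {n : ℕ} (s : ℕ) (x : Fin n → ℂ) : ℝ :=
  sInf {t : ℝ | ∃ z : Fin n → ℂ, IsSparse s z ∧ t = l1norm (x - z)}

/-- `η_{s,k}(λ) = (s + λ²k)/min{s, λ²k}`. -/
noncomputable def etaSK (s k : ℕ) (lam : ℝ) : ℝ :=
  ((s : ℝ) + lam ^ 2 * k) / min (s : ℝ) (lam ^ 2 * k)

/-- The ℓ¹-robust null space property of order (s,k) with weight lam, constants ρ, τ. -/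
def L1RNSP {m N : ℕ} (A : Matrix (Fin m) (Fin N) ℂ) (s k : ℕ) (lam ρ τ : ℝ) : Prop :=
  ∀ (x : Fin N → ℂ) (c : Fin m → ℂ) (S : Finset (Fin N)) (T : Finset (Fin m)),
    S.card ≤ s → T.card ≤ k →
      l1norm (restr x S) + lam * l1norm (restr c T) ≤
        ρ * (l1norm (restr x Sᶜ) + lam * l1norm (restr c Tᶜ)) + τ * l2norm (A.mulVec x + c)

/-- The ℓ²-robust null space property of order (s,k) with weight lam, constants ρ, τ. -/
def L2RNSP {m N : ℕ} (A : Matrix (Fin m) (Fin N) ℂ) (s k : ℕ) (lam ρ τ : ℝ) : Prop :=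
  ∀ (x : Fin N → ℂ) (c : Fin m → ℂ) (S : Finset (Fin N)) (T : Finset (Fin m)),
    S.card ≤ s → T.card ≤ k →
      Real.sqrt (l2norm (restr x S) ^ 2 + l2norm (restr c T) ^ 2) ≤
        (ρ / Real.sqrt ((s : ℝ) + lam ^ 2 * k)) *
            (l1norm (restr x Sᶜ) + lam * l1norm (restr c Tᶜ)) +
          τ * l2norm (A.mulVec x + c)

/-- `A` satisfies the two-sided RIP inequality for the sparse corruptions problem of
order `(s,k)` with constant `δ`. -/
def RIPCor {m N : ℕ} (A : Matrix (Fin m) (Fin N) ℂ) (s k : ℕ) (δ : ℝ) : Prop :=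
  ∀ (x : Fin N → ℂ) (c : Fin m → ℂ), IsSparse s x → IsSparse k c →
    (1 - δ) * (l2norm x ^ 2 + l2norm c ^ 2) ≤ l2norm (A.mulVec x + c) ^ 2 ∧
      l2norm (A.mulVec x + c) ^ 2 ≤ (1 + δ) * (l2norm x ^ 2 + l2norm c ^ 2)

/-- `A` satisfies the RIP inequality for sparse vectors of order `s` with constant `δ`. -/
def RIPSparse {m N : ℕ} (A : Matrix (Fin m) (Fin N) ℂ) (s : ℕ) (δ : ℝ) : Prop :=
  ∀ x : Fin N → ℂ, IsSparse s x →
    (1 - δ) * l2norm x ^ 2 ≤ l2norm (A.mulVec x) ^ 2 ∧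
      l2norm (A.mulVec x) ^ 2 ≤ (1 + δ) * l2norm x ^ 2

/-- `(xh, ch)` is a minimizer of `‖z‖₁ + lam ‖d‖₁` subject to `‖Az + d - y‖₂ ≤ ε`. -/
def IsMinimizer {m N : ℕ} (A : Matrix (Fin m) (Fin N) ℂ) (y : Fin m → ℂ) (lam ε : ℝ)
    (xh : Fin N → ℂ) (ch : Fin m → ℂ) : Prop :=
  l2norm (A.mulVec xh + ch - y) ≤ ε ∧
    ∀ (z : Fin N → ℂ) (d : Fin m → ℂ), l2norm (A.mulVec z + d - y) ≤ ε →
      l1norm xh + lam * l1norm ch ≤ l1norm z + lam * l1norm d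

/-- Spectral norm of a matrix (operator norm w.r.t. Euclidean norms). -/
noncomputable def specNorm {a b : ℕ} (B : Matrix (Fin a) (Fin b) ℂ) : ℝ :=
  ‖LinearMap.toContinuousLinearMap (Matrix.toEuclideanLin B)‖

/-- `σ_{s,k}(A)`: the maximum spectral norm over `k × s` submatrices of `A`. -/
noncomputable def sigmaSK {m N : ℕ} (A : Matrix (Fin m) (Fin N) ℂ) (s k : ℕ) : ℝ :=
  sSup {t : ℝ | ∃ (S : Finset (Fin N)) (T : Finset (Fin m)) (hS : S.card = s) (hT : T.card = k),
    t = specNorm (A.submatrix (fun i : Fin k => ((T.orderIsoOfFin hT i : Fin m)))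
      (fun j : Fin s => ((S.orderIsoOfFin hS j : Fin N))))}


lemma l2norm_nonneg {n : ℕ} (x : Fin n → ℂ) : 0 ≤ l2norm x := Real.sqrt_nonneg _

lemma l2norm_sq {n : ℕ} (x : Fin n → ℂ) : l2norm x ^ 2 = ∑ i, ‖x i‖ ^ 2 :=
  Real.sq_sqrt (Finset.sum_nonneg fun _ _ => by positivity)

lemma l1norm_nonneg {n : ℕ} (x : Fin n → ℂ) : 0 ≤ l1norm x :=
  Finset.sum_nonneg fun _ _ => norm_nonneg _

lemma l1norm_restr {n : ℕ} (x : Fin n → ℂ) (S : Finset (Fin n)) :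
    l1norm (restr x S) = ∑ i ∈ S, ‖x i‖ := by
  unfold l1norm restr
  simp [apply_ite norm]

lemma l2norm_restr_sq {n : ℕ} (x : Fin n → ℂ) (S : Finset (Fin n)) :
    l2norm (restr x S) ^ 2 = ∑ i ∈ S, ‖x i‖ ^ 2 := by
  rw [l2norm_sq, ← Finset.sum_filter_add_sum_filter_not Finset.univ (· ∈ S)]
  have h1 : ∑ i ∈ Finset.univ.filter (· ∈ S), ‖restr x S i‖ ^ 2 = ∑ i ∈ S, ‖x i‖ ^ 2 := by
    rw [Finset.filter_mem_eq_inter, Finset.univ_inter]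
    exact Finset.sum_congr rfl fun i hi => by simp [restr, hi]
  have h2 : ∑ i ∈ Finset.univ.filter (fun i => ¬ i ∈ S), ‖restr x S i‖ ^ 2 = 0 :=
    Finset.sum_eq_zero fun i hi => by
      have : i ∉ S := by simpa using hi
      simp [restr, this]
  rw [h1, h2, add_zero]

lemma restr_union {n : ℕ} (x : Fin n → ℂ) (S T : Finset (Fin n)) (h : Disjoint S T) :
    restr x (S ∪ T) = restr x S + restr x T := by
  funext i
  by_cases h1 : i ∈ S
  · have h2 : i ∉ T := Finset.disjoint_left.1 h h1
    simp [restr, h1, h2]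
  · by_cases h2 : i ∈ T <;> simp [restr, h1, h2]

lemma restr_univ {n : ℕ} (x : Fin n → ℂ) : restr x Finset.univ = x := by
  funext i; simp [restr]

lemma restr_empty {n : ℕ} (x : Fin n → ℂ) : restr x ∅ = 0 := by
  funext i; simp [restr]

/-- top-`s` subset of `U` -/
lemma exists_top {n : ℕ} (f : Fin n → ℝ) (s : ℕ) : ∀ (U : Finset (Fin n)), s ≤ U.card →
    ∃ W ⊆ U, W.card = s ∧ ∀ i ∈ W, ∀ j ∈ U \ W, f j ≤ f i := by
  induction s with
  | zero => intro U _; exact ⟨∅, by simp, by simp, by simp⟩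
  | succ s ih =>
    intro U hU
    obtain ⟨W, hWU, hWc, hW⟩ := ih U (by omega)
    have hne : (U \ W).Nonempty := by
      rw [← Finset.card_pos, Finset.card_sdiff_of_subset hWU]; omega
    obtain ⟨a, ha, hmax⟩ := Finset.exists_max_image (U \ W) f hne
    have ha' := Finset.mem_sdiff.1 ha
    refine ⟨insert a W, Finset.insert_subset ha'.1 hWU, ?_, ?_⟩
    · rw [Finset.card_insert_of_notMem ha'.2, hWc]
    · intro i hi j hj
      have hj' : j ∈ U \ W := by
        simp only [Finset.mem_sdiff, Finset.mem_insert, not_or] at hj ⊢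
        exact ⟨hj.1, hj.2.2⟩
      rcases Finset.mem_insert.1 hi with rfl | hi
      · exact hmax j hj'
      · exact hW i hi j hj'

/-- square root lifting inequality for a block -/
lemma block_lift {n : ℕ} (v : Fin n → ℂ) (W : Finset (Fin n)) (s : ℕ) (hs : 1 ≤ s)
    (M μ : ℝ) (hμ : 0 ≤ μ) (hμM : μ ≤ M) (hW : W.card ≤ s) (hc : W.card = s ∨ μ = 0)
    (hM : ∀ i ∈ W, ‖v i‖ ≤ M) (hm : ∀ i ∈ W, μ ≤ ‖v i‖) :
    l2norm (restr v W) ≤ l1norm (restr v W) / Real.sqrt s + Real.sqrt s * (M - μ) / 4 := by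
  have hs0 : (0 : ℝ) < s := by exact_mod_cast hs
  have hq : 0 < Real.sqrt s := Real.sqrt_pos.2 hs0
  have hqs : Real.sqrt s ^ 2 = s := Real.sq_sqrt hs0.le
  have hL := l1norm_nonneg (restr v W)
  have hsum : l2norm (restr v W) ^ 2 ≤ (M + μ) * l1norm (restr v W) - s * (M * μ) := by
    have h1 : l2norm (restr v W) ^ 2 ≤ (M + μ) * l1norm (restr v W) - W.card * (M * μ) := by
      rw [l2norm_restr_sq, l1norm_restr, Finset.mul_sum, ← nsmul_eq_mul, ← Finset.sum_const,
        ← Finset.sum_sub_distrib]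
      apply Finset.sum_le_sum
      intro i hi
      nlinarith [mul_nonneg (sub_nonneg.2 (hM i hi)) (sub_nonneg.2 (hm i hi))]
    rcases hc with h | h
    · rwa [h] at h1
    · subst h; simpa using h1
  apply abs_le_of_sq_le_sq' _ _ |>.2
  · set L := l1norm (restr v W)
    set r := Real.sqrt (s : ℝ)
    obtain ⟨l, hl⟩ : ∃ l, l = L / r := ⟨_, rfl⟩
    have hLl : L = r * l := by rw [hl]; field_simp
    rw [← hl]
    refine hsum.trans ?_
    rw [hLl, ← hqs]
    nlinarith [sq_nonneg (l - r * (M + 3 * μ) / 4), mul_nonneg (mul_nonneg hμ (sub_nonneg.2 hμM)) (sq_nonneg r)]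
  · have : 0 ≤ M - μ := sub_nonneg.2 hμM
    positivity

lemma lift_sum {n : ℕ} (v : Fin n → ℂ) (s : ℕ) (hs : 1 ≤ s) (K : ℝ) (hK : 0 ≤ K)
    (L : (Fin n → ℂ) → ℝ) (hadd : ∀ a b, L (a + b) = L a + L b) :
    ∀ (c : ℕ) (U : Finset (Fin n)), U.card = c → ∀ M : ℝ, 0 ≤ M → (∀ i ∈ U, ‖v i‖ ≤ M) →
    (∀ W ⊆ U, W.card ≤ s → L (restr v W) ≤ K * l2norm (restr v W)) →
    L (restr v U) ≤ K * (l1norm (restr v U) / Real.sqrt s + Real.sqrt s * M / 4) := by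
  intro c
  induction c using Nat.strong_induction_on with
  | _ c ih =>
  intro U hUc M hM0 hM hL
  by_cases h : U.card ≤ s
  · refine (hL U subset_rfl h).trans (mul_le_mul_of_nonneg_left ?_ hK)
    have := block_lift v U s hs M 0 le_rfl hM0 h (Or.inr rfl) hM (fun i _ => norm_nonneg _)
    simpa using this
  · push Not at h
    obtain ⟨W, hWU, hWc, hW⟩ := exists_top (fun i => ‖v i‖) s U h.le
    have hWne : W.Nonempty := by rw [← Finset.card_pos]; omega
    obtain ⟨a, ha, hmin⟩ := Finset.exists_min_image W (fun i => ‖v i‖) hWne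
    have hcard : (U \ W).card < c := by rw [Finset.card_sdiff_of_subset hWU]; omega
    have h1 := ih _ hcard (U \ W) rfl ‖v a‖ (norm_nonneg _) (fun j hj => hW a ha j hj)
      (fun W' hW' hc => hL W' (hW'.trans Finset.sdiff_subset) hc)
    have h2 := block_lift v W s hs M ‖v a‖ (norm_nonneg _) (hM a (hWU ha)) hWc.le (Or.inl hWc)
      (fun i hi => hM i (hWU hi)) hmin
    have h3 := (hL W hWU hWc.le).trans (mul_le_mul_of_nonneg_left h2 hK)
    have hU : U = W ∪ (U \ W) := (Finset.union_sdiff_of_subset hWU).symm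
    have hl1 : l1norm (restr v U) = l1norm (restr v W) + l1norm (restr v (U \ W)) := by
      simp only [l1norm_restr]; rw [add_comm, Finset.sum_sdiff hWU]
    have hLU : L (restr v U) = L (restr v W) + L (restr v (U \ W)) := by
      conv_lhs => rw [hU]
      rw [restr_union _ _ _ Finset.disjoint_sdiff, hadd]
    rw [hLU, hl1]
    refine (add_le_add h3 h1).trans (le_of_eq ?_)
    ring

/-- first block extraction -/
lemma first_block {n : ℕ} (v : Fin n → ℂ) (s : ℕ) (hs : 1 ≤ s) (K : ℝ) (hK : 0 ≤ K)
    (L : (Fin n → ℂ) → ℝ) (hadd : ∀ a b, L (a + b) = L a + L b)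
    (U : Finset (Fin n)) (M : ℝ) (hM0 : 0 ≤ M) (hM : ∀ i ∈ U, ‖v i‖ ≤ M)
    (hL : ∀ W ⊆ U, W.card ≤ s → L (restr v W) ≤ K * l2norm (restr v W)) :
    ∃ W ⊆ U, W.card ≤ s ∧
      L (restr v (U \ W)) ≤ K * (l1norm (restr v U) / Real.sqrt s) ∧
      L (restr v (U \ W)) ≤ K * (l1norm (restr v U) / Real.sqrt s + Real.sqrt s * M / 4
        - l2norm (restr v W)) := by
  have hs0 : (0 : ℝ) < s := by exact_mod_cast hs
  have hq : 0 < Real.sqrt s := Real.sqrt_pos.2 hs0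
  have hqs : Real.sqrt s ^ 2 = s := Real.sq_sqrt hs0.le
  by_cases h : U.card ≤ s
  · refine ⟨U, subset_rfl, h, ?_, ?_⟩
    · have h0 : L (restr v (U \ U)) = 0 := by
        rw [Finset.sdiff_self, restr_empty]
        have := hadd 0 0
        simp at this; exact this
      rw [h0]
      have := l1norm_nonneg (restr v U)
      positivity
    · have h0 : L (restr v (U \ U)) = 0 := by
        rw [Finset.sdiff_self, restr_empty]
        have := hadd 0 0
        simp at this; exact this
      rw [h0]
      have := block_lift v U s hs M 0 le_rfl hM0 h (Or.inr rfl) hM (fun i _ => norm_nonneg _)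
      rw [sub_zero] at this
      exact mul_nonneg hK (by linarith)
  · push Not at h
    obtain ⟨W, hWU, hWc, hW⟩ := exists_top (fun i => ‖v i‖) s U h.le
    have hWne : W.Nonempty := by rw [← Finset.card_pos]; omega
    obtain ⟨a, ha, hmin⟩ := Finset.exists_min_image W (fun i => ‖v i‖) hWne
    have h1 := lift_sum v s hs K hK L hadd _ (U \ W) rfl ‖v a‖ (norm_nonneg _)
      (fun j hj => hW a ha j hj)
      (fun W' hW' hc => hL W' (hW'.trans Finset.sdiff_subset) hc)
    have h2 := block_lift v W s hs M ‖v a‖ (norm_nonneg _) (hM a (hWU ha)) hWc.le (Or.inl hWc)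
      (fun i hi => hM i (hWU hi)) hmin
    have hl1 : l1norm (restr v U) = l1norm (restr v W) + l1norm (restr v (U \ W)) := by
      simp only [l1norm_restr]; rw [add_comm, Finset.sum_sdiff hWU]
    have hav : Real.sqrt s * ‖v a‖ ≤ l1norm (restr v W) / Real.sqrt s := by
      rw [le_div_iff₀ hq]
      have : (s : ℝ) * ‖v a‖ ≤ l1norm (restr v W) := by
        rw [l1norm_restr, ← hWc, ← nsmul_eq_mul, ← Finset.sum_const]
        exact Finset.sum_le_sum hmin
      have e : Real.sqrt s * ‖v a‖ * Real.sqrt s = Real.sqrt s ^ 2 * ‖v a‖ := by ring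
      rw [e, hqs]; exact this
    refine ⟨W, hWU, hWc.le, ?_, ?_⟩
    · refine h1.trans (mul_le_mul_of_nonneg_left ?_ hK)
      rw [hl1, add_div]
      have : 0 ≤ Real.sqrt s * ‖v a‖ := by positivity
      linarith
    · refine h1.trans (mul_le_mul_of_nonneg_left ?_ hK)
      rw [hl1, add_div]
      linarith

noncomputable def rdot {n : ℕ} (u v : Fin n → ℂ) : ℝ :=
  ∑ i, ((u i).re * (v i).re + (u i).im * (v i).im)

lemma rdot_add {n : ℕ} (u v w : Fin n → ℂ) : rdot u (v + w) = rdot u v + rdot u w := by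
  unfold rdot
  rw [← Finset.sum_add_distrib]
  exact Finset.sum_congr rfl fun i _ => by simp; ring

lemma rdot_self {n : ℕ} (u : Fin n → ℂ) : rdot u u = l2norm u ^ 2 := by
  rw [l2norm_sq]
  exact Finset.sum_congr rfl fun i _ => by rw [Complex.sq_norm, Complex.normSq_apply]

lemma l2norm_comb_sq {n : ℕ} (u v : Fin n → ℂ) (a b : ℝ) :
    l2norm ((a : ℂ) • u + (b : ℂ) • v) ^ 2 =
      a ^ 2 * l2norm u ^ 2 + 2 * a * b * rdot u v + b ^ 2 * l2norm v ^ 2 := by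
  simp only [l2norm_sq, rdot, Finset.mul_sum]
  rw [← Finset.sum_add_distrib, ← Finset.sum_add_distrib]
  refine Finset.sum_congr rfl fun i _ => ?_
  simp only [Complex.sq_norm, Complex.normSq_apply]
  simp
  ring

lemma disc {P q R : ℝ} (h : ∀ a b : ℝ, 0 ≤ a ^ 2 * P + 2 * a * b * q + b ^ 2 * R) :
    q ^ 2 ≤ P * R := by
  have := discrim_le_zero (a := P) (b := 2 * q) (c := R) (fun x => by
    have := h x 1; nlinarith)
  unfold discrim at this
  nlinarith

lemma rdot_le {n : ℕ} (u v : Fin n → ℂ) : rdot u v ≤ l2norm u * l2norm v := by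
  apply abs_le_of_sq_le_sq' _ (mul_nonneg (l2norm_nonneg u) (l2norm_nonneg v)) |>.2
  rw [mul_pow]
  apply disc
  intro a b
  rw [← l2norm_comb_sq]; positivity

/-- real lemma -/
lemma quad_key {δ X Y q n0 n1 : ℝ} (hδ0 : 0 ≤ δ) (hn1 : 0 ≤ n1)
    (h : ∀ a b : ℝ, (1 - δ) * (a ^ 2 * n0 + b ^ 2 * n1) ≤ a ^ 2 * X + 2 * a * b * q + b ^ 2 * Y ∧
      a ^ 2 * X + 2 * a * b * q + b ^ 2 * Y ≤ (1 + δ) * (a ^ 2 * n0 + b ^ 2 * n1))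
    (hn0 : 0 ≤ n0) (hδ1 : δ < 1) :
    n0 * q ^ 2 * (1 - δ ^ 2) ≤ δ ^ 2 * X ^ 2 * n1 := by
  have d1 : q ^ 2 ≤ (X - (1 - δ) * n0) * (Y - (1 - δ) * n1) :=
    disc fun a b => by linarith [(h a b).1]
  have d2 : (-q) ^ 2 ≤ ((1 + δ) * n0 - X) * ((1 + δ) * n1 - Y) :=
    disc fun a b => by linarith [(h a b).2]
  have p1 : 0 ≤ X - (1 - δ) * n0 := by linarith [(h 1 0).1]
  have p2 : 0 ≤ (1 + δ) * n0 - X := by linarith [(h 1 0).2]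
  have e : (2 * δ) * (n0 * q ^ 2) ≤
      (2 * δ) * ((X - (1 - δ) * n0) * ((1 + δ) * n0 - X) * n1) := by
    nlinarith [mul_le_mul_of_nonneg_left d1 p2, mul_le_mul_of_nonneg_left d2 p1]
  have hd : 0 < 1 - δ ^ 2 := by nlinarith
  rcases hδ0.eq_or_lt with h0 | h0
  · subst h0
    have hX : X = n0 := by linarith
    subst hX
    have : q ^ 2 ≤ 0 := by nlinarith
    nlinarith
  · have e2 := le_of_mul_le_mul_left e (by positivity)
    have e3 : (X - (1 - δ) * n0) * ((1 + δ) * n0 - X) * (1 - δ ^ 2) ≤ δ ^ 2 * X ^ 2 := by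
      nlinarith [sq_nonneg (X - (1 - δ ^ 2) * n0)]
    calc n0 * q ^ 2 * (1 - δ ^ 2) ≤ _ := mul_le_mul_of_nonneg_right e2 hd.le
      _ = ((X - (1 - δ) * n0) * ((1 + δ) * n0 - X) * (1 - δ ^ 2)) * n1 := by ring
      _ ≤ _ := mul_le_mul_of_nonneg_right e3 hn1

lemma rdot_restr_disjoint {n : ℕ} (x : Fin n → ℂ) (S T : Finset (Fin n)) (h : Disjoint S T) :
    rdot (restr x S) (restr x T) = 0 := by
  apply Finset.sum_eq_zero
  intro i _
  by_cases h1 : i ∈ S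
  · have h2 : i ∉ T := Finset.disjoint_left.1 h h1
    simp [restr, h2]
  · simp [restr, h1]

lemma sparse_comb {n s : ℕ} (x : Fin n → ℂ) (S T : Finset (Fin n)) (hS : S.card ≤ s)
    (hT : T.card ≤ s) (a b : ℂ) : IsSparse (2 * s) (a • restr x S + b • restr x T) := by
  refine ⟨S ∪ T, (Finset.card_union_le _ _).trans (by omega), ?_⟩
  intro i hi
  simp only [Finset.mem_union, not_or] at hi
  simp [restr, hi.1, hi.2]

lemma cross_bound {m N s k : ℕ} {δ : ℝ} (hδ0 : 0 ≤ δ) (hδ1 : δ < 1)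
    (A : Matrix (Fin m) (Fin N) ℂ) (hA : RIPCor A (2 * s) (2 * k) δ)
    (v : Fin N → ℂ) (w : Fin m → ℂ) (S S' : Finset (Fin N)) (T T' : Finset (Fin m))
    (hS : S.card ≤ s) (hS' : S'.card ≤ s) (hT : T.card ≤ k) (hT' : T'.card ≤ k)
    (hSS : Disjoint S S') (hTT : Disjoint T T') :
    Real.sqrt (l2norm (restr v S) ^ 2 + l2norm (restr w T) ^ 2) *
      |rdot (A.mulVec (restr v S) + restr w T) (A.mulVec (restr v S') + restr w T')| ≤
    δ / Real.sqrt (1 - δ ^ 2) * l2norm (A.mulVec (restr v S) + restr w T) ^ 2 *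
      Real.sqrt (l2norm (restr v S') ^ 2 + l2norm (restr w T') ^ 2) := by
  have hd : 0 < 1 - δ ^ 2 := by nlinarith
  have key := quad_key (δ := δ) (X := l2norm (A.mulVec (restr v S) + restr w T) ^ 2)
    (Y := l2norm (A.mulVec (restr v S') + restr w T') ^ 2)
    (q := rdot (A.mulVec (restr v S) + restr w T) (A.mulVec (restr v S') + restr w T'))
    (n0 := l2norm (restr v S) ^ 2 + l2norm (restr w T) ^ 2)
    (n1 := l2norm (restr v S') ^ 2 + l2norm (restr w T') ^ 2) hδ0 (by positivity)
    (by
      intro a b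
      have := hA _ _ (sparse_comb v S S' hS hS' (a : ℂ) b) (sparse_comb w T T' hT hT' (a : ℂ) b)
      have e : A.mulVec ((a : ℂ) • restr v S + (b : ℂ) • restr v S') +
          ((a : ℂ) • restr w T + (b : ℂ) • restr w T') =
          (a : ℂ) • (A.mulVec (restr v S) + restr w T) +
          (b : ℂ) • (A.mulVec (restr v S') + restr w T') := by
        rw [Matrix.mulVec_add, Matrix.mulVec_smul, Matrix.mulVec_smul, smul_add, smul_add]
        abel
      rw [e, l2norm_comb_sq, l2norm_comb_sq, l2norm_comb_sq, rdot_restr_disjoint v S S' hSS,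
        rdot_restr_disjoint w T T' hTT] at this
      constructor
      · refine le_trans (le_of_eq ?_) this.1; ring
      · refine this.2.trans (le_of_eq ?_); ring)
    (by positivity) hδ1
  apply abs_le_of_sq_le_sq' _ (by positivity) |>.2
  rw [mul_pow, mul_pow, mul_pow, div_pow, sq_abs, Real.sq_sqrt hd.le, Real.sq_sqrt (by positivity),
    Real.sq_sqrt (by positivity), div_mul_eq_mul_div, div_mul_eq_mul_div, le_div_iff₀ hd]
  exact key

lemma gain_le {p q a b d e : ℝ} (hp : 0 ≤ p) (hq : 0 ≤ q) (ha : 0 ≤ a) (hb : 0 ≤ b)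
    (hd0 : d ≤ 0) (hda : d ≤ a - p) (he0 : e ≤ 0) (heb : e ≤ b - q) :
    Real.sqrt (p ^ 2 + q ^ 2) + d + e ≤ Real.sqrt (a ^ 2 + b ^ 2) := by
  have h1 : ∀ x y z t : ℝ, 0 ≤ x → x ≤ z → 0 ≤ y → y ≤ t →
      Real.sqrt (x ^ 2 + y ^ 2) ≤ Real.sqrt (z ^ 2 + t ^ 2) := fun x y z t h1 h2 h3 h4 =>
    Real.sqrt_le_sqrt (by gcongr)
  have hs : ∀ x y u : ℝ, 0 ≤ x → 0 ≤ y → 0 ≤ u →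
      Real.sqrt ((x + u) ^ 2 + y ^ 2) ≤ Real.sqrt (x ^ 2 + y ^ 2) + u := by
    intro x y u hx hy hu
    rw [Real.sqrt_le_left (by positivity)]
    have hh : x ≤ Real.sqrt (x ^ 2 + y ^ 2) := Real.le_sqrt_of_sq_le (by nlinarith)
    have := Real.sq_sqrt (show 0 ≤ x ^ 2 + y ^ 2 by positivity)
    nlinarith
  have hs2 : ∀ x y u : ℝ, 0 ≤ x → 0 ≤ y → 0 ≤ u →
      Real.sqrt (x ^ 2 + (y + u) ^ 2) ≤ Real.sqrt (x ^ 2 + y ^ 2) + u := by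
    intro x y u hx hy hu
    have := hs y x u hy hx hu
    rwa [add_comm, add_comm (x ^ 2)]
  have i1 := h1 p q (a - d) (b - e) hp (by linarith) hq (by linarith)
  have i2 := hs a (b - e) (-d) ha (by linarith) (by linarith)
  have i3 := hs2 a b (-e) ha hb (by linarith)
  simp only [← sub_eq_add_neg] at i2 i3
  linarith

lemma top_le {n s : ℕ} (hs : 1 ≤ s) (v : Fin n → ℂ) (S : Finset (Fin n)) (hS : S.card = s)
    (htop : ∀ i ∈ S, ∀ j ∈ Finset.univ \ S, ‖v j‖ ≤ ‖v i‖) :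
    ∃ M, 0 ≤ M ∧ (∀ j ∈ Sᶜ, ‖v j‖ ≤ M) ∧ Real.sqrt s * M ≤ l2norm (restr v S) := by
  have hne : S.Nonempty := by rw [← Finset.card_pos]; omega
  obtain ⟨a, ha, hmin⟩ := Finset.exists_min_image S (fun i => ‖v i‖) hne
  refine ⟨‖v a‖, norm_nonneg _, fun j hj => htop a ha j (by simpa using hj), ?_⟩
  apply abs_le_of_sq_le_sq' _ (l2norm_nonneg _) |>.2
  rw [mul_pow, Real.sq_sqrt (by positivity), l2norm_restr_sq, ← hS, ← nsmul_eq_mul,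
    ← Finset.sum_const]
  exact Finset.sum_le_sum fun i hi => by
    have := hmin i hi
    gcongr

lemma l1_le_l2 {n s : ℕ} (v : Fin n → ℂ) (S : Finset (Fin n)) (hS : S.card = s) :
    l1norm (restr v S) ≤ Real.sqrt s * l2norm (restr v S) := by
  apply abs_le_of_sq_le_sq' _ (mul_nonneg (Real.sqrt_nonneg _) (l2norm_nonneg _)) |>.2
  rw [mul_pow, Real.sq_sqrt (by positivity), l2norm_restr_sq, l1norm_restr, ← hS]
  exact sq_sum_le_card_mul_sum_sq

lemma split_compl {n : ℕ} (v : Fin n → ℂ) (S : Finset (Fin n)) :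
    v = restr v S + restr v Sᶜ := by
  rw [← restr_union _ _ _ disjoint_compl_right, Finset.union_compl, restr_univ]

set_option maxHeartbeats 1000000 in
/-- main estimate for the top sets -/
lemma main_top {m N s k : ℕ} {δ : ℝ} (hδ0 : 0 ≤ δ) (hδ1 : δ < 1) (hs : 1 ≤ s) (hk : 1 ≤ k)
    (A : Matrix (Fin m) (Fin N) ℂ) (hA : RIPCor A (2 * s) (2 * k) δ)
    (v : Fin N → ℂ) (w : Fin m → ℂ) (S : Finset (Fin N)) (T : Finset (Fin m))
    (hS : S.card = s) (hT : T.card = k)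
    (hStop : ∀ i ∈ S, ∀ j ∈ Finset.univ \ S, ‖v j‖ ≤ ‖v i‖)
    (hTtop : ∀ i ∈ T, ∀ j ∈ Finset.univ \ T, ‖w j‖ ≤ ‖w i‖) :
    Real.sqrt (l2norm (restr v S) ^ 2 + l2norm (restr w T) ^ 2) ≤
      δ / Real.sqrt (1 - δ ^ 2) * (l1norm (restr v Sᶜ) / Real.sqrt s +
        l1norm (restr w Tᶜ) / Real.sqrt k +
        Real.sqrt (l2norm (restr v S) ^ 2 + l2norm (restr w T) ^ 2) / 4) +
      l2norm (A.mulVec v + w) / Real.sqrt (1 - δ) := by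
  have hd : 0 < 1 - δ ^ 2 := by nlinarith
  have hd1 : 0 < Real.sqrt (1 - δ) := Real.sqrt_pos.2 (by linarith)
  set θ := δ / Real.sqrt (1 - δ ^ 2) with hθ
  have hθ0 : 0 ≤ θ := by positivity
  set n0 := Real.sqrt (l2norm (restr v S) ^ 2 + l2norm (restr w T) ^ 2) with hn0
  have hEv := l1norm_nonneg (restr v Sᶜ)
  have hEw := l1norm_nonneg (restr w Tᶜ)
  have hMa := l2norm_nonneg (A.mulVec v + w)
  have hn0n : 0 ≤ n0 := Real.sqrt_nonneg _
  rcases hn0n.eq_or_lt with h0 | h0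
  · rw [← h0]; positivity
  have hn0sq : n0 ^ 2 = l2norm (restr v S) ^ 2 + l2norm (restr w T) ^ 2 :=
    Real.sq_sqrt (by positivity)
  set g := A.mulVec (restr v S) + restr w T with hg
  have hXlow : (1 - δ) * n0 ^ 2 ≤ l2norm g ^ 2 := by
    rw [hn0sq]
    exact (hA _ _ ⟨S, by omega, fun i hi => by simp [restr, hi]⟩
      ⟨T, by omega, fun i hi => by simp [restr, hi]⟩).1
  have hgn : Real.sqrt (1 - δ) * n0 ≤ l2norm g := by
    apply abs_le_of_sq_le_sq' _ (l2norm_nonneg _) |>.2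
    rw [mul_pow, Real.sq_sqrt (by linarith)]; exact hXlow
  have hgpos : 0 < l2norm g := lt_of_lt_of_le (by positivity) hgn
  obtain ⟨Mv, hMv0, hMv, hMvS⟩ := top_le hs v S hS hStop
  obtain ⟨Mw, hMw0, hMw, hMwT⟩ := top_le hk w T hT hTtop
  set K := θ * l2norm g ^ 2 / n0 with hKdef
  have hK : 0 ≤ K := by positivity
  have hcross : ∀ S' ⊆ Sᶜ, ∀ T' ⊆ Tᶜ, S'.card ≤ s → T'.card ≤ k →
      -rdot g (A.mulVec (restr v S') + restr w T') ≤
        K * Real.sqrt (l2norm (restr v S') ^ 2 + l2norm (restr w T') ^ 2) := by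
    intro S' hS' T' hT' hc hc'
    have := cross_bound hδ0 hδ1 A hA v w S S' T T' hS.le hc hT.le hc'
      (disjoint_compl_right.mono_right hS') (disjoint_compl_right.mono_right hT')
    rw [← hn0, ← hθ, ← hg] at this
    refine (neg_le_abs _).trans ?_
    rw [hKdef, div_mul_eq_mul_div, le_div_iff₀ h0, mul_comm]
    exact this
  have hz1 : l2norm (0 : Fin N → ℂ) = 0 := by simp [l2norm]
  have hz2 : l2norm (0 : Fin m → ℂ) = 0 := by simp [l2norm]
  obtain ⟨S1, hS1, hS1c, a1, a2⟩ := first_block v s hs K hK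
    (fun u => -rdot g (A.mulVec u)) (fun a b => by
      rw [Matrix.mulVec_add, rdot_add]; ring) Sᶜ Mv hMv0 hMv
    (fun W hW hc => by
      have := hcross W hW ∅ (by simp) hc (by simp)
      rw [restr_empty, add_zero, hz2] at this
      simpa [Real.sqrt_sq (l2norm_nonneg _)] using this)
  obtain ⟨T1, hT1, hT1c, b1, b2⟩ := first_block w k hk K hK
    (fun u => -rdot g u) (fun a b => by rw [rdot_add]; ring) Tᶜ Mw hMw0 hMw
    (fun W hW hc => by
      have := hcross ∅ (by simp) W hW (by simp) hc
      rw [restr_empty, Matrix.mulVec_zero, zero_add, hz1] at this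
      simpa [Real.sqrt_sq (l2norm_nonneg _)] using this)
  have c1 := hcross S1 hS1 T1 hT1 hS1c hT1c
  have dv : restr v Sᶜ = restr v S1 + restr v (Sᶜ \ S1) := by
    rw [← restr_union _ _ _ Finset.disjoint_sdiff, Finset.union_sdiff_of_subset hS1]
  have dw : restr w Tᶜ = restr w T1 + restr w (Tᶜ \ T1) := by
    rw [← restr_union _ _ _ Finset.disjoint_sdiff, Finset.union_sdiff_of_subset hT1]
  have htot : A.mulVec v + w = g + ((A.mulVec (restr v S1) + restr w T1) +
      (A.mulVec (restr v (Sᶜ \ S1)) + restr w (Tᶜ \ T1))) := by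
    conv_lhs => rw [split_compl v S, split_compl w T, dv, dw]
    rw [Matrix.mulVec_add, Matrix.mulVec_add, hg]
    abel
  have hX : l2norm g ^ 2 = rdot g (A.mulVec v + w) +
      -rdot g (A.mulVec (restr v S1) + restr w T1) +
      -rdot g (A.mulVec (restr v (Sᶜ \ S1))) + -rdot g (restr w (Tᶜ \ T1)) := by
    rw [htot, rdot_add g g, rdot_add g (A.mulVec (restr v S1) + restr w T1),
      rdot_add g (A.mulVec (restr v (Sᶜ \ S1))), rdot_self]
    ring
  -- bound the complement
  set p := l2norm (restr v S1)
  set q := l2norm (restr w T1)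
  set ev := l1norm (restr v Sᶜ) / Real.sqrt s
  set ew := l1norm (restr w Tᶜ) / Real.sqrt k
  have hgain := gain_le (p := p) (q := q) (a := l2norm (restr v S) / 4) (b := l2norm (restr w T) / 4)
    (d := min 0 (l2norm (restr v S) / 4 - p)) (e := min 0 (l2norm (restr w T) / 4 - q))
    (l2norm_nonneg _) (l2norm_nonneg _) (by linarith [l2norm_nonneg (restr v S)])
    (by linarith [l2norm_nonneg (restr w T)]) (min_le_left _ _) (min_le_right _ _)
    (min_le_left _ _) (min_le_right _ _)
  have hquart : Real.sqrt ((l2norm (restr v S) / 4) ^ 2 + (l2norm (restr w T) / 4) ^ 2) = n0 / 4 := by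
    rw [Real.sqrt_eq_iff_mul_self_eq (by positivity) (by positivity)]
    nlinarith
  rw [hquart] at hgain
  have a3 : -rdot g (A.mulVec (restr v (Sᶜ \ S1))) ≤
      K * (ev + min 0 (l2norm (restr v S) / 4 - p)) := by
    rcases min_choice 0 (l2norm (restr v S) / 4 - p) with h | h <;> rw [h]
    · simpa using a1
    · exact a2.trans (mul_le_mul_of_nonneg_left (by linarith) hK)
  have b3 : -rdot g (restr w (Tᶜ \ T1)) ≤
      K * (ew + min 0 (l2norm (restr w T) / 4 - q)) := by
    rcases min_choice 0 (l2norm (restr w T) / 4 - q) with h | h <;> rw [h]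
    · simpa using b1
    · exact b2.trans (mul_le_mul_of_nonneg_left (by linarith) hK)
  have hfin : l2norm g ^ 2 ≤ l2norm g * l2norm (A.mulVec v + w) + K * (ev + ew + n0 / 4) := by
    have := rdot_le g (A.mulVec v + w)
    have := mul_le_mul_of_nonneg_left hgain hK
    rw [hX]
    linarith
  -- divide
  have h3 : l2norm g * n0 ≤ n0 * l2norm (A.mulVec v + w) + θ * l2norm g * (ev + ew + n0 / 4) := by
    have e1 : K * n0 = θ * l2norm g ^ 2 := by rw [hKdef]; exact div_mul_cancel₀ _ h0.ne'
    have e2 := mul_le_mul_of_nonneg_right hfin h0.le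
    have e3 : l2norm g * (l2norm g * n0) ≤
        l2norm g * (n0 * l2norm (A.mulVec v + w) + θ * l2norm g * (ev + ew + n0 / 4)) := by
      calc l2norm g * (l2norm g * n0) = l2norm g ^ 2 * n0 := by ring
        _ ≤ _ := e2
        _ = l2norm g * l2norm (A.mulVec v + w) * n0 + (K * n0) * (ev + ew + n0 / 4) := by ring
        _ = _ := by rw [e1]; ring
    exact le_of_mul_le_mul_left e3 hgpos
  have h4 : n0 * l2norm (A.mulVec v + w) ≤ l2norm g * (l2norm (A.mulVec v + w) / Real.sqrt (1 - δ)) := by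
    rw [mul_div_assoc', le_div_iff₀ hd1]
    nlinarith
  refine le_of_mul_le_mul_left ?_ hgpos
  linarith

lemma l1_split {n : ℕ} (v : Fin n → ℂ) (S : Finset (Fin n)) :
    l1norm (restr v S) + l1norm (restr v Sᶜ) = l1norm v := by
  rw [l1norm_restr, l1norm_restr, Finset.sum_add_sum_compl]; rfl

lemma top_l1 {n s : ℕ} (v : Fin n → ℂ) (S S' : Finset (Fin n)) (hS : S.card = s)
    (htop : ∀ i ∈ S, ∀ j ∈ Finset.univ \ S, ‖v j‖ ≤ ‖v i‖) (hS' : S'.card ≤ s) :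
    l1norm (restr v S') ≤ l1norm (restr v S) := by
  rw [l1norm_restr, l1norm_restr, ← Finset.sum_inter_add_sum_sdiff S' S,
    ← Finset.sum_inter_add_sum_sdiff S S', Finset.inter_comm]
  gcongr 1
  have hcard : (S' \ S).card ≤ (S \ S').card := by
    have h1 := Finset.card_inter_add_card_sdiff S' S
    have h2 := Finset.card_inter_add_card_sdiff S S'
    rw [Finset.inter_comm] at h2
    omega
  rcases (S' \ S).eq_empty_or_nonempty with h | h
  · rw [h, Finset.sum_empty]; exact Finset.sum_nonneg fun _ _ => norm_nonneg _
  · have hne : (S \ S').Nonempty := by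
      rw [← Finset.card_pos] at h ⊢; omega
    obtain ⟨a, ha, hmin⟩ := Finset.exists_min_image (S \ S') (fun i => ‖v i‖) hne
    have ha' := (Finset.mem_sdiff.1 ha).1
    calc ∑ i ∈ S' \ S, ‖v i‖ ≤ ∑ i ∈ S' \ S, ‖v a‖ := Finset.sum_le_sum fun j hj =>
          htop a ha' j (by simp [(Finset.mem_sdiff.1 hj).2])
      _ = (S' \ S).card * ‖v a‖ := by simp
      _ ≤ (S \ S').card * ‖v a‖ := by gcongr
      _ = ∑ i ∈ S \ S', ‖v a‖ := by simp
      _ ≤ _ := Finset.sum_le_sum hmin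

lemma eta_facts {s k : ℕ} (hs : 1 ≤ s) (hk : 1 ≤ k) {lam : ℝ} (hl : 0 < lam) :
    1 / Real.sqrt s ≤ Real.sqrt (etaSK s k lam) / Real.sqrt (s + lam ^ 2 * k) ∧
    1 / Real.sqrt k ≤ Real.sqrt (etaSK s k lam) / Real.sqrt (s + lam ^ 2 * k) * lam := by
  have hs0 : (0 : ℝ) < s := by exact_mod_cast hs
  have hk0 : (0 : ℝ) < k := by exact_mod_cast hk
  have hD : (0 : ℝ) < s + lam ^ 2 * k := by positivity
  have hmin : 0 < min (s : ℝ) (lam ^ 2 * k) := lt_min hs0 (by positivity)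
  have e : Real.sqrt (etaSK s k lam) / Real.sqrt (s + lam ^ 2 * k) =
      1 / Real.sqrt (min (s : ℝ) (lam ^ 2 * k)) := by
    unfold etaSK
    rw [Real.sqrt_div hD.le]
    have := (Real.sqrt_pos.2 hD).ne'
    field_simp
  rw [e]
  constructor
  · exact one_div_le_one_div_of_le (Real.sqrt_pos.2 hmin) (Real.sqrt_le_sqrt (min_le_left _ _))
  · have h1 := one_div_le_one_div_of_le (Real.sqrt_pos.2 hmin)
      (Real.sqrt_le_sqrt (min_le_right (s : ℝ) (lam ^ 2 * k)))
    refine le_trans (le_of_eq ?_) (mul_le_mul_of_nonneg_right h1 hl.le)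
    rw [Real.sqrt_mul (by positivity), Real.sqrt_sq hl.le]
    have := (Real.sqrt_pos.2 hk0).ne'
    field_simp

lemma rnsp_of_rip {m N s k : ℕ} {δ ρ lam : ℝ} (hδ0 : 0 ≤ δ) (hδ1 : δ < 1) (hs : 1 ≤ s)
    (hk : 1 ≤ k) (hsN : s ≤ N) (hkm : k ≤ m) (hl : 0 < lam)
    (A : Matrix (Fin m) (Fin N) ℂ) (hA : RIPCor A (2 * s) (2 * k) δ) (hρ0 : 0 ≤ ρ)
    (hθ : δ / Real.sqrt (1 - δ ^ 2) / 4 < 1)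
    (hρ : δ / Real.sqrt (1 - δ ^ 2) * Real.sqrt (etaSK s k lam) ≤
      ρ * (1 - δ / Real.sqrt (1 - δ ^ 2) / 4)) :
    L1RNSP A s k lam ρ (1 / (Real.sqrt (1 - δ) * (1 - δ / Real.sqrt (1 - δ ^ 2) / 4)) *
      Real.sqrt (s + lam ^ 2 * k)) := by
  intro v w S' T' hS' hT'
  obtain ⟨S, -, hS, hStop⟩ := exists_top (fun i => ‖v i‖) s Finset.univ (by simpa using hsN)
  obtain ⟨T, -, hT, hTtop⟩ := exists_top (fun i => ‖w i‖) k Finset.univ (by simpa using hkm)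
  have hmain := main_top hδ0 hδ1 hs hk A hA v w S T hS hT hStop hTtop
  obtain ⟨f1, f2⟩ := eta_facts hs hk hl
  have hs0 : (0 : ℝ) < s := by exact_mod_cast hs
  have hD : (0 : ℝ) < s + lam ^ 2 * k := by positivity
  have hsD := Real.sqrt_pos.2 hD
  have hd : 0 < 1 - δ ^ 2 := by nlinarith
  have hd1 : 0 < Real.sqrt (1 - δ) := Real.sqrt_pos.2 (by linarith)
  have hθ0 : 0 ≤ δ / Real.sqrt (1 - δ ^ 2) := by positivity
  generalize δ / Real.sqrt (1 - δ ^ 2) = θ at *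
  set n0 := Real.sqrt (l2norm (restr v S) ^ 2 + l2norm (restr w T) ^ 2)
  set n := l2norm (A.mulVec v + w)
  set sD := Real.sqrt (s + lam ^ 2 * k) with hsDdef
  set E := l1norm (restr v Sᶜ) + lam * l1norm (restr w Tᶜ) with hE
  have hE0 : 0 ≤ E := add_nonneg (l1norm_nonneg _) (mul_nonneg hl.le (l1norm_nonneg _))
  have hev : l1norm (restr v Sᶜ) / Real.sqrt s + l1norm (restr w Tᶜ) / Real.sqrt k ≤
      Real.sqrt (etaSK s k lam) / sD * E := by
    have g1 := mul_le_mul_of_nonneg_right f1 (l1norm_nonneg (restr v Sᶜ))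
    have g2 := mul_le_mul_of_nonneg_right f2 (l1norm_nonneg (restr w Tᶜ))
    rw [one_div_mul_eq_div] at g1 g2
    rw [hE]; linarith
  have hc : 0 < 1 - θ / 4 := by linarith
  have h1 : n0 * (1 - θ / 4) ≤ ρ * (1 - θ / 4) * (E / sD) + n / Real.sqrt (1 - δ) := by
    have g1 := mul_le_mul_of_nonneg_left hev hθ0
    have g2 := mul_le_mul_of_nonneg_right hρ (show 0 ≤ E / sD by positivity)
    have g3 : θ * (Real.sqrt (etaSK s k lam) / sD * E) =
      θ * Real.sqrt (etaSK s k lam) * (E / sD) := by ring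
    linarith
  have h2 : sD * n0 ≤ ρ * E + 1 / (Real.sqrt (1 - δ) * (1 - θ / 4)) * sD * n := by
    refine le_of_mul_le_mul_right ?_ hc
    have := mul_le_mul_of_nonneg_left h1 hsD.le
    refine le_trans (le_of_eq (by ring)) (this.trans (le_of_eq ?_))
    have hcne := hc.ne'
    generalize 1 - θ / 4 = cc at hcne ⊢
    field_simp
  have h3 : l1norm (restr v S) + lam * l1norm (restr w T) ≤ sD * n0 := by
    have g1 := l1_le_l2 v S hS
    have g2 := mul_le_mul_of_nonneg_left (l1_le_l2 w T hT) hl.le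
    refine (add_le_add g1 g2).trans ?_
    apply abs_le_of_sq_le_sq' _ (by positivity) |>.2
    rw [mul_pow, Real.sq_sqrt hD.le, Real.sq_sqrt (by positivity)]
    have q1 := Real.sq_sqrt hs0.le
    have q2 := Real.sq_sqrt (show (0 : ℝ) ≤ k by positivity)
    generalize Real.sqrt (s : ℝ) = a at *
    generalize Real.sqrt (k : ℝ) = b at *
    rw [← q1, ← q2]
    nlinarith [sq_nonneg (a * l2norm (restr w T) - lam * b * l2norm (restr v S))]
  have t1 := top_l1 v S S' hS hStop hS'
  have t2 := mul_le_mul_of_nonneg_left (top_l1 w T T' hT hTtop hT') hl.le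
  have u1 := l1_split v S
  have u2 := l1_split v S'
  have u3 := l1_split w T
  have u4 := l1_split w T'
  have hEE : E ≤ l1norm (restr v S'ᶜ) + lam * l1norm (restr w T'ᶜ) := by
    have : lam * l1norm (restr w Tᶜ) ≤ lam * l1norm (restr w T'ᶜ) :=
      mul_le_mul_of_nonneg_left (by linarith [top_l1 w T T' hT hTtop hT']) hl.le
    rw [hE]; linarith
  have := mul_le_mul_of_nonneg_left hEE hρ0
  linarith

lemma cone_aux {n : ℕ} (x xh : Fin n → ℂ) (S : Finset (Fin n)) :
    l1norm (restr (x - xh) Sᶜ) ≤ l1norm (restr (x - xh) S) + 2 * l1norm (restr x Sᶜ)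
      + (l1norm xh - l1norm x) := by
  rw [← l1_split xh S, ← l1_split x S]
  simp only [l1norm_restr]
  have h1 : ∑ i ∈ Sᶜ, ‖(x - xh) i‖ ≤ ∑ i ∈ Sᶜ, ‖x i‖ + ∑ i ∈ Sᶜ, ‖xh i‖ := by
    rw [← Finset.sum_add_distrib]
    exact Finset.sum_le_sum fun i _ => norm_sub_le _ _
  have h2 : ∑ i ∈ S, ‖x i‖ ≤ ∑ i ∈ S, ‖(x - xh) i‖ + ∑ i ∈ S, ‖xh i‖ := by
    rw [← Finset.sum_add_distrib]
    exact Finset.sum_le_sum fun i _ => by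
      have := norm_add_le (x i - xh i) (xh i)
      simpa using this
  linarith

lemma exists_sigma {n s : ℕ} (x : Fin n → ℂ) (e : ℝ) (he : 0 < e) :
    ∃ S : Finset (Fin n), S.card ≤ s ∧ l1norm (restr x Sᶜ) ≤ sigma1 s x + e := by
  obtain ⟨t, ⟨z, ⟨S, hS, hz⟩, rfl⟩, ht⟩ := exists_lt_of_csInf_lt
    (s := {t : ℝ | ∃ z : Fin n → ℂ, IsSparse s z ∧ t = l1norm (x - z)})
    ⟨_, 0, ⟨∅, by simp, by simp⟩, rfl⟩ (show sInf _ < sigma1 s x + e by unfold sigma1; linarith)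
  refine ⟨S, hS, le_trans ?_ ht.le⟩
  rw [← l1_split (x - z) S]
  have : l1norm (restr x Sᶜ) = l1norm (restr (x - z) Sᶜ) := by
    rw [l1norm_restr, l1norm_restr]
    exact Finset.sum_congr rfl fun i hi => by
      simp [hz i (by simpa using hi)]
  rw [this]
  linarith [l1norm_nonneg (restr (x - z) S)]

lemma l2norm_sub_le {n : ℕ} (u v : Fin n → ℂ) : l2norm (u - v) ≤ l2norm u + l2norm v := by
  have h := l2norm_comb_sq u v 1 (-1)
  have h' := rdot_le u (-v)
  have e : u - v = ((1 : ℝ) : ℂ) • u + ((-1 : ℝ) : ℂ) • v := by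
    funext i; simp; ring
  have e2 : rdot u (-v) = - rdot u v := by simp [rdot, ← Finset.sum_neg_distrib]; 
                                           exact Finset.sum_congr rfl fun i _ => by ring
  have e3 : l2norm (-v) = l2norm v := by simp [l2norm]
  rw [e2, e3] at h'
  apply abs_le_of_sq_le_sq' _ (add_nonneg (l2norm_nonneg _) (l2norm_nonneg _)) |>.2
  rw [e, h]
  nlinarith

lemma recovery {m N s k : ℕ} {ρ τ lam : ℝ} (hρ0 : 0 ≤ ρ) (hρ1 : ρ < 1) (hτ : 0 ≤ τ) (hl : 0 < lam)
    (A : Matrix (Fin m) (Fin N) ℂ) (hA : L1RNSP A s k lam ρ τ)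
    (x : Fin N → ℂ) (c y : Fin m → ℂ) (ε : ℝ) (hy : l2norm (A.mulVec x + c - y) ≤ ε)
    (xh : Fin N → ℂ) (ch : Fin m → ℂ) (hmin : IsMinimizer A y lam ε xh ch) :
    l1norm (x - xh) + lam * l1norm (c - ch) ≤
      2 * (1 + ρ) / (1 - ρ) * (sigma1 s x + lam * sigma1 k c) + 4 / (1 - ρ) * τ * ε := by
  have hr : 0 < 1 - ρ := by linarith
  apply le_of_forall_pos_le_add
  intro e he
  obtain ⟨e', he', hee⟩ : ∃ e', 0 < e' ∧ 2 * (1 + ρ) / (1 - ρ) * ((1 + lam) * e') = e := by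
    refine ⟨e / (2 * (1 + ρ) / (1 - ρ) * (1 + lam)), by positivity, ?_⟩
    field_simp
  obtain ⟨S, hS, hSx⟩ := exists_sigma (s := s) x e' he'
  obtain ⟨T, hT, hTc⟩ := exists_sigma (s := k) c e' he'
  have h1 := hA (x - xh) (c - ch) S T hS hT
  have hn : l2norm (A.mulVec (x - xh) + (c - ch)) ≤ 2 * ε := by
    have e1 : A.mulVec (x - xh) + (c - ch) =
        (A.mulVec x + c - y) - (A.mulVec xh + ch - y) := by
      rw [Matrix.mulVec_sub]; abel
    rw [e1]
    linarith [l2norm_sub_le (A.mulVec x + c - y) (A.mulVec xh + ch - y), hmin.1]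
  have hτn := mul_le_mul_of_nonneg_left hn hτ
  have c1 := cone_aux x xh S
  have c2 := mul_le_mul_of_nonneg_left (cone_aux c ch T) hl.le
  have hm := hmin.2 x c hy
  have hTc' := mul_le_mul_of_nonneg_left hTc hl.le
  rw [← l1_split (x - xh) S, ← l1_split (c - ch) T, ← hee]
  have hE : (1 - ρ) * (l1norm (restr (x - xh) Sᶜ) + lam * l1norm (restr (c - ch) Tᶜ)) ≤
      2 * (sigma1 s x + lam * sigma1 k c + (1 + lam) * e') + τ * (2 * ε) := by
    linarith
  have hE' := mul_le_mul_of_nonneg_left hE (show 0 ≤ 1 + ρ by linarith)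
  refine le_of_mul_le_mul_left ?_ hr
  have rhs : (1 - ρ) * (2 * (1 + ρ) / (1 - ρ) * (sigma1 s x + lam * sigma1 k c) + 4 / (1 - ρ) * τ * ε
      + 2 * (1 + ρ) / (1 - ρ) * ((1 + lam) * e')) =
      (1 + ρ) * (2 * (sigma1 s x + lam * sigma1 k c + (1 + lam) * e')) + 4 * τ * ε := by
    field_simp
    ring
  rw [rhs]
  have hB := mul_le_mul_of_nonneg_left (h1.trans (add_le_add_right hτn _)) hr.le
  nlinarith

/-- uniform contraction constant -/
lemma exists_rho (θ h : ℝ) (hθ0 : 0 ≤ θ) (hh : 1 / 4 < h) (hθ : θ * h < 1) :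
    ∃ ρ, 0 ≤ ρ ∧ ρ < 1 ∧ ∀ r : ℝ, θ * (h + r) < 1 → θ * r ≤ ρ * (1 - θ / 4) := by
  rcases hθ0.eq_or_lt with h0 | h0
  · subst h0; exact ⟨0, le_rfl, one_pos, fun r _ => by simp⟩
  · have hc : 0 < 1 - θ / 4 := by nlinarith
    refine ⟨(1 - θ * h) / (1 - θ / 4), by apply div_nonneg <;> linarith, ?_, ?_⟩
    · rw [div_lt_one hc]; nlinarith
    · intro r hr
      rw [div_mul_cancel₀ _ hc.ne']; linarith

lemma threshold {δ h r : ℝ} (hδ0 : 0 ≤ δ) (hh : 0 ≤ h) (hr : 0 ≤ r)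
    (hδ : δ < 1 / Real.sqrt (1 + (h + r) ^ 2)) :
    δ < 1 ∧ δ / Real.sqrt (1 - δ ^ 2) * (h + r) < 1 := by
  have hp : 0 < 1 + (h + r) ^ 2 := by positivity
  rw [lt_div_iff₀ (Real.sqrt_pos.2 hp)] at hδ
  have h2 : δ ^ 2 * (1 + (h + r) ^ 2) < 1 := by
    have : (δ * Real.sqrt (1 + (h + r) ^ 2)) ^ 2 < 1 :=
      (sq_lt_one_iff₀ (by positivity)).2 hδ
    rwa [mul_pow, Real.sq_sqrt hp.le] at this
  have hδ1 : δ < 1 := by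
    by_contra hc
    push Not at hc
    nlinarith [sq_nonneg (δ * (h + r))]
  have hd : 0 < 1 - δ ^ 2 := by nlinarith
  refine ⟨hδ1, ?_⟩
  rw [div_mul_eq_mul_div, div_lt_one (Real.sqrt_pos.2 hd)]
  apply Real.lt_sqrt_of_sq_lt
  nlinarith

/-- ℓ¹ recovery estimate under the RIP for sparse corruptions, with constants
depending only on the restricted isometry constant δ. -/
theorem l1_recovery_of_rip (δ : ℝ) (hδ0 : 0 ≤ δ) :
    ∃ C₁ C₂ : ℝ, 0 < C₁ ∧ 0 < C₂ ∧
      ∀ (N m s k : ℕ), 1 ≤ s → s ≤ N → 1 ≤ k → k ≤ m → m ≤ N →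
        ∀ lam : ℝ, 0 < lam →
          δ < 1 / Real.sqrt (1 + (1 / (2 * Real.sqrt 2) + Real.sqrt (etaSK s k lam)) ^ 2) →
          ∀ A : Matrix (Fin m) (Fin N) ℂ, RIPCor A (2 * s) (2 * k) δ →
            ∀ (x : Fin N → ℂ) (c y : Fin m → ℂ) (ε : ℝ), 0 < ε →
              l2norm (A.mulVec x + c - y) ≤ ε →
              ∀ (xh : Fin N → ℂ) (ch : Fin m → ℂ), IsMinimizer A y lam ε xh ch →
                l1norm (x - xh) + lam * l1norm (c - ch) ≤
                  C₁ * (sigma1 s x + lam * sigma1 k c) +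
                    C₂ * Real.sqrt ((s : ℝ) + lam ^ 2 * k) * ε := by
  have hh0 : 0 ≤ 1 / (2 * Real.sqrt 2) := by positivity
  have hh : 1 / 4 < 1 / (2 * Real.sqrt 2) := by
    apply one_div_lt_one_div_of_lt (by positivity)
    have : Real.sqrt 2 < 2 := by
      rw [Real.sqrt_lt' (by norm_num)]; norm_num
    linarith
  by_cases H : δ < 1 ∧ δ / Real.sqrt (1 - δ ^ 2) * (1 / (2 * Real.sqrt 2)) < 1
  · obtain ⟨hδ1, hθh⟩ := H
    have hd : 0 < 1 - δ ^ 2 := by nlinarith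
    have hd1 : 0 < Real.sqrt (1 - δ) := Real.sqrt_pos.2 (by linarith)
    have hθ0 : 0 ≤ δ / Real.sqrt (1 - δ ^ 2) := by positivity
    have hθ4 : δ / Real.sqrt (1 - δ ^ 2) / 4 < 1 := by nlinarith
    obtain ⟨ρ, hρ0, hρ1, hρ⟩ := exists_rho _ _ hθ0 hh hθh
    have hr : 0 < 1 - ρ := by linarith
    have hc : 0 < 1 - δ / Real.sqrt (1 - δ ^ 2) / 4 := by linarith
    refine ⟨2 * (1 + ρ) / (1 - ρ),
      4 / (1 - ρ) * (1 / (Real.sqrt (1 - δ) * (1 - δ / Real.sqrt (1 - δ ^ 2) / 4))),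
      by positivity, by positivity, ?_⟩
    intro N m s k hs hsN hk hkm hmN lam hl hδ A hA x c y ε hε hy xh ch hmin
    have ht := threshold hδ0 hh0 (Real.sqrt_nonneg _) hδ
    have hR := rnsp_of_rip hδ0 hδ1 hs hk hsN hkm hl A hA hρ0 hθ4 (hρ _ ht.2)
    have := recovery hρ0 hρ1 (by positivity) hl A hR x c y ε hy xh ch hmin
    rw [← mul_assoc] at this
    exact this
  · refine ⟨1, 1, one_pos, one_pos, ?_⟩
    intro N m s k hs hsN hk hkm hmN lam hl hδ
    exfalso
    apply H
    have ht := threshold hδ0 hh0 (Real.sqrt_nonneg _) hδ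
    refine ⟨ht.1, lt_of_le_of_lt ?_ ht.2⟩
    have hθ0 : 0 ≤ δ / Real.sqrt (1 - δ ^ 2) := by positivity
    have := Real.sqrt_nonneg (etaSK s k lam)
    gcongr
    linarith
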